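/- arXiv:math/9811067 — 2 statements merged into one kernel-verified Lean document; each statement's English description precedes it below -/
import Mathlib

section
/- For every positive integer n, the sequence a_0, a_1, ..., a_{n-1}, where a_k is the number of 132-avoiding permutations of [n] having exactly k descents, is unimodal: there exists an index m such that a_0 ≤ a_1 ≤ ... ≤ a_m and a_m ≥ a_{m+1} ≥ ... ≥ a_{n-1}. -/
/-- A permutation `p` of `[n]` (modelled on `Fin n`, 0-based) is 132-avoiding if there
are no positions `i < j < k` with `p i < p k < p j`. -/
def Avoids132 {n : ℕ} (p : Equiv.Perm (Fin n)) : Prop :=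
  ¬ ∃ i j k : Fin n, i < j ∧ j < k ∧ p i < p k ∧ p k < p j

/-- The descent set of `p`, in the 1-based convention of the paper: `i ∈ D(p)` iff
`1 ≤ i ≤ n-1` and `p_i > p_{i+1}`, where `p_i` denotes the `i`-th entry of `p` in
1-based indexing (so `p_i = p ⟨i-1⟩` in 0-based indexing). -/
def DescentSet {n : ℕ} (p : Equiv.Perm (Fin n)) : Finset ℕ :=
  (Finset.range n).filter (fun i => ∃ h : 1 ≤ i ∧ i < n, p ⟨i, h.2⟩ < p ⟨i - 1, by omega⟩)

/-- The number of 132-avoiding permutations of `[n]` with exactly `k` descents. -/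
noncomputable def countDesc (n k : ℕ) : ℕ :=
  Nat.card {p : Equiv.Perm (Fin n) // Avoids132 p ∧ (DescentSet p).card = k}

open Finset Polynomial

namespace BinaryTree

/-- The word of the decreasing binary tree of shape `t` labelled by `o, …, o + numNodes t - 1`, in
which all labels of a left subtree exceed those of the corresponding right subtree. -/
def word132 : BinaryTree Unit → ℕ → List ℕ
  | nil, _ => []
  | node _ l r, o =>
    word132 l (o + r.numNodes) ++ (o + l.numNodes + r.numNodes) :: word132 r o

/-- The number of right edges of a binary tree. -/
def rightEdges : BinaryTree Unit → ℕ
  | nil => 0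
  | node _ l r => rightEdges l + rightEdges r + if r.numNodes = 0 then 0 else 1

@[simp]
theorem length_word132 (t : BinaryTree Unit) (o : ℕ) : (word132 t o).length = t.numNodes := by
  induction t generalizing o with
  | nil => rfl
  | node a l r hl hr => simp [word132, hl, hr]; omega

@[simp]
theorem mem_word132 (t : BinaryTree Unit) (o x : ℕ) :
    x ∈ word132 t o ↔ o ≤ x ∧ x < o + t.numNodes := by
  induction t generalizing o with
  | nil => simp [word132]
  | node a l r hl hr => simp [word132, hl, hr]; omega

theorem nodup_word132 (t : BinaryTree Unit) (o : ℕ) : (word132 t o).Nodup := by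
  induction t generalizing o with
  | nil => simp [word132]
  | node a l r hl hr =>
    simp only [word132, List.nodup_append, List.nodup_cons, List.mem_cons, mem_word132, hl, hr,
      true_and]
    refine ⟨⟨by omega, trivial⟩, fun x hx y hy => by omega⟩

theorem word132_injective (o : ℕ) {t t' : BinaryTree Unit} (h : word132 t o = word132 t' o) :
    t = t' := by
  induction t generalizing o t' with
  | nil =>
    cases t' with
    | nil => rfl
    | node a l r => simp [word132] at h
  | node a l r hl hr =>
    cases t' with
    | nil => simp [word132] at h
    | node a' l' r' =>
      have hlen : l.numNodes + r.numNodes = l'.numNodes + r'.numNodes := by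
        have := congrArg List.length h
        simp [word132] at this
        omega
      simp only [word132] at h
      have hlr : word132 l (o + r.numNodes) = word132 l' (o + r'.numNodes) ∧
          word132 r o = word132 r' o := by
        rw [List.append_eq_append_iff] at h
        have hm := mem_word132 l (o + r.numNodes) (o + l.numNodes + r.numNodes)
        have hm' := mem_word132 l' (o + r'.numNodes) (o + l.numNodes + r.numNodes)
        rcases h with ⟨as, h1, h2⟩ | ⟨as, h1, h2⟩
        · cases as with
          | nil => simp_all
          | cons b as =>
            simp only [List.cons_append, List.cons.injEq] at h2
            rw [h1, ← h2.1] at hm'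
            simp at hm'
            omega
        · cases as with
          | nil => simp_all
          | cons b as =>
            simp only [List.cons_append, List.cons.injEq] at h2
            rw [h1, ← h2.1] at hm
            simp at hm
            omega
      have hrr := hr o hlr.2
      subst hrr
      rw [hl _ hlr.1]

end BinaryTree

namespace List

/-- A list of natural numbers with no subsequence of pattern 132. -/
abbrev Avoids132 (l : List ℕ) : Prop := l.Triplewise fun a b c => ¬ (a < c ∧ c < b)

/-- The number of descents of a list of natural numbers. -/
def numDescents : List ℕ → ℕ
  | a :: b :: l => (if b < a then 1 else 0) + numDescents (b :: l)
  | _ => 0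

theorem numDescents_append_cons {l₁ l₂ : List ℕ} {m : ℕ} (h₁ : ∀ x ∈ l₁, x < m)
    (h₂ : ∀ x ∈ l₂, x < m) :
    (l₁ ++ m :: l₂).numDescents =
      l₁.numDescents + l₂.numDescents + if l₂.length = 0 then 0 else 1 := by
  induction l₁ with
  | nil =>
    cases l₂ with
    | nil => simp [numDescents]
    | cons b l => simp [numDescents, h₂ b]; omega
  | cons a l₁ ih =>
    have ih := ih fun x hx => h₁ x (by simp [hx])
    cases l₁ with
    | nil =>
      have := h₁ a (by simp)
      simp only [nil_append, cons_append, numDescents] at ih ⊢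
      rw [ih, if_neg (by omega)]
      omega
    | cons b l₁ =>
      simp only [cons_append, numDescents] at ih ⊢
      omega

theorem numDescents_eq_sum (l : List ℕ) :
    l.numDescents = ∑ i ∈ Finset.range (l.length - 1),
      if l.getD (i + 1) 0 < l.getD i 0 then 1 else 0 := by
  induction l with
  | nil => simp [numDescents]
  | cons a l ih =>
    cases l with
    | nil => simp [numDescents]
    | cons b l =>
      rw [numDescents, ih]
      simp only [length_cons, Nat.add_sub_cancel]
      rw [Finset.sum_range_succ', add_comm]
      simp

/-- If the members of two lists fill an interval, and those of the first exceed those of the second,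
then the second occupies the lower part of the interval. -/
theorem mem_iff_of_partition {l₁ l₂ : List ℕ} {o : ℕ} (h₂ : l₂.Nodup)
    (hlt : ∀ a ∈ l₁, ∀ c ∈ l₂, c < a)
    (hmem : ∀ x, x ∈ l₁ ∨ x ∈ l₂ ↔ o ≤ x ∧ x < o + l₁.length + l₂.length) :
    (∀ x, x ∈ l₁ ↔ o + l₂.length ≤ x ∧ x < o + l₂.length + l₁.length) ∧
      ∀ x, x ∈ l₂ ↔ o ≤ x ∧ x < o + l₂.length := by
  have hc₂ : l₂.toFinset.card = l₂.length := toFinset_card_of_nodup h₂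
  have hsub : l₂.toFinset ⊆ Finset.Ico o (o + l₂.length) := by
    intro b hb
    rw [mem_toFinset] at hb
    have hb' := (hmem b).1 (Or.inr hb)
    have hs : Finset.Icc o b ⊆ l₂.toFinset := by
      intro x hx
      rw [Finset.mem_Icc] at hx
      rw [mem_toFinset]
      rcases (hmem x).2 (by omega) with h | h
      · have := hlt x h b hb
        omega
      · exact h
    have := Finset.card_le_card hs
    rw [hc₂, Nat.card_Icc] at this
    rw [Finset.mem_Ico]
    omega
  have heq := Finset.eq_of_subset_of_card_le hsub (by simp [hc₂])
  have hm₂ : ∀ x, x ∈ l₂ ↔ o ≤ x ∧ x < o + l₂.length := fun x => by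
    rw [← mem_toFinset, heq, Finset.mem_Ico]
  refine ⟨fun x => ⟨fun hx => ?_, fun hx => ?_⟩, hm₂⟩
  · have h := (hmem x).1 (Or.inl hx)
    have hn : x ∉ l₂ := fun hx₂ => lt_irrefl _ (hlt x hx x hx₂)
    rw [hm₂] at hn
    omega
  · rcases (hmem x).2 (by omega) with h | h
    · exact h
    · rw [hm₂] at h
      omega

end List

namespace BinaryTree

theorem avoids132_word132 (t : BinaryTree Unit) (o : ℕ) : (word132 t o).Avoids132 := by
  induction t generalizing o with
  | nil => simp [word132]
  | node a l r hl hr =>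
    simp only [word132, List.Avoids132, List.triplewise_append, List.triplewise_cons] at hl hr ⊢
    refine ⟨hl _, ⟨List.pairwise_of_forall_mem_list ?_, hr _⟩, fun x hx => ?_, fun x hx => ?_⟩
    · intro x hx y hy
      simp at hx hy
      omega
    · refine List.pairwise_of_forall_mem_list fun y hy z hz => ?_
      simp at hx hy hz
      omega
    · refine List.pairwise_of_forall_mem_list fun y hy z hz => ?_
      simp at hx hy hz
      omega

theorem numDescents_word132 (t : BinaryTree Unit) (o : ℕ) :
    (word132 t o).numDescents = t.rightEdges := by
  induction t generalizing o with
  | nil => rfl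
  | node a l r hl hr =>
    rw [word132, List.numDescents_append_cons, hl, hr, rightEdges, length_word132]
    · intro x hx
      simp at hx
      omega
    · intro x hx
      simp at hx
      omega

theorem exists_word132_eq (n o : ℕ) (l : List ℕ) (hlen : l.length = n) (hnd : l.Nodup)
    (hmem : ∀ x, x ∈ l ↔ o ≤ x ∧ x < o + n) (hav : l.Avoids132) :
    ∃ t : BinaryTree Unit, t.numNodes = n ∧ word132 t o = l := by
  induction n using Nat.strong_induction_on generalizing o l with
  | _ n ih =>
    cases n with
    | zero => exact ⟨nil, rfl, (List.eq_nil_of_length_eq_zero hlen).symm⟩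
    | succ n =>
      obtain ⟨l₁, l₂, rfl⟩ := List.append_of_mem ((hmem (o + n)).2 (by omega))
      simp only [List.length_append, List.length_cons] at hlen
      simp only [List.nodup_append, List.nodup_cons, List.mem_cons] at hnd
      obtain ⟨hnd₁, ⟨hn₂, hnd₂⟩, hne⟩ := hnd
      simp only [List.Avoids132, List.triplewise_append, List.triplewise_cons,
        List.pairwise_cons] at hav
      obtain ⟨hav₁, ⟨-, hav₂⟩, hav₃, -⟩ := hav
      simp only [List.mem_append, List.mem_cons] at hmem
      have hn₁ : o + n ∉ l₁ := fun h => hne _ h _ (Or.inl rfl) rfl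
      have hlt : ∀ a ∈ l₁, ∀ c ∈ l₂, c < a := by
        intro a ha c hc
        have h1 := (hav₃ a ha).1 c hc
        have h2 := hne a ha c (Or.inr hc)
        have h3 := (hmem c).1 (Or.inr (Or.inr hc))
        have h4 : c ≠ o + n := fun h => hn₂ (h ▸ hc)
        omega
      obtain ⟨hm₁, hm₂⟩ := List.mem_iff_of_partition (o := o) hnd₂ hlt fun x => by
        have h := hmem x
        constructor
        · intro hx
          have hxn : x ≠ o + n := by
            rintro rfl
            exact hx.elim hn₁ hn₂
          have := h.1 (hx.imp_right Or.inr)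
          omega
        · intro hx
          rcases h.2 (by omega) with h | h | h
          · exact Or.inl h
          · omega
          · exact Or.inr h
      obtain ⟨t₁, ht₁, hw₁⟩ := ih l₁.length (by omega) (o + l₂.length) l₁ rfl hnd₁ hm₁ hav₁
      obtain ⟨t₂, ht₂, hw₂⟩ := ih l₂.length (by omega) o l₂ rfl hnd₂ hm₂ hav₂
      refine ⟨node () t₁ t₂, by simp only [numNodes]; omega, ?_⟩
      rw [word132, ht₁, ht₂, hw₁, hw₂]
      congr 2
      omega

end BinaryTree

/-- The word of a permutation of `Fin n`. -/
def permWord {n : ℕ} (p : Equiv.Perm (Fin n)) : List ℕ := List.ofFn fun i => (p i : ℕ)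

theorem permWord_injective {n : ℕ} : Function.Injective (permWord (n := n)) := by
  intro p q h
  ext i
  exact congrFun (List.ofFn_injective h) i

theorem avoids132_permWord {n : ℕ} (p : Equiv.Perm (Fin n)) :
    (permWord p).Avoids132 ↔ Avoids132 p := by
  simp only [permWord, List.Avoids132, List.triplewise_iff_getElem, List.getElem_ofFn,
    List.length_ofFn, Avoids132, Fin.val_fin_lt]
  constructor
  · rintro h ⟨i, j, k, hij, hjk, hp⟩
    exact h i j k hij hjk k.2 hp
  · intro h i j k hij hjk hk hp
    exact h ⟨⟨i, by omega⟩, ⟨j, by omega⟩, ⟨k, hk⟩, hij, hjk, hp⟩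

theorem numDescents_permWord {n : ℕ} (p : Equiv.Perm (Fin n)) :
    (permWord p).numDescents = (DescentSet p).card := by
  rw [List.numDescents_eq_sum, ← card_filter]
  refine card_bij (fun i _ => i + 1) ?_ (by simp) ?_
  · intro i hi
    simp only [permWord, List.length_ofFn, mem_filter, mem_range] at hi
    obtain ⟨hi, hlt⟩ := hi
    rw [List.getD_eq_getElem _ _ (by simp; omega), List.getD_eq_getElem _ _ (by simp; omega)] at hlt
    simp only [List.getElem_ofFn, Fin.val_fin_lt] at hlt
    simp only [DescentSet, mem_filter, mem_range]
    exact ⟨by omega, ⟨by omega, by omega⟩, hlt⟩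
  · intro i hi
    simp only [DescentSet, mem_filter, mem_range] at hi
    obtain ⟨-, ⟨h1, hn⟩, hlt⟩ := hi
    obtain ⟨j, rfl⟩ := Nat.exists_eq_add_of_le' h1
    refine ⟨j, ?_, rfl⟩
    simp only [permWord, List.length_ofFn, mem_filter, mem_range]
    refine ⟨by omega, ?_⟩
    rw [List.getD_eq_getElem _ _ (by simp; omega), List.getD_eq_getElem _ _ (by simp; omega)]
    simpa using hlt

theorem mem_permWord {n : ℕ} (p : Equiv.Perm (Fin n)) (x : ℕ) : x ∈ permWord p ↔ x < n := by
  simp only [permWord, List.mem_ofFn]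
  constructor
  · rintro ⟨i, rfl⟩
    exact (p i).2
  · intro hx
    exact ⟨p.symm ⟨x, hx⟩, by simp⟩

theorem nodup_permWord {n : ℕ} (p : Equiv.Perm (Fin n)) : (permWord p).Nodup :=
  List.nodup_ofFn.2 (Fin.val_injective.comp p.injective)

theorem exists_permWord_eq {n : ℕ} {l : List ℕ} (hlen : l.length = n) (hnd : l.Nodup)
    (hlt : ∀ x ∈ l, x < n) : ∃ p : Equiv.Perm (Fin n), permWord p = l := by
  subst hlen
  let f : Fin l.length → Fin l.length := fun i => ⟨l[i], hlt _ (by simp)⟩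
  have hf : Function.Injective f := fun i j h =>
    List.nodup_iff_injective_get.1 hnd (by simpa [f] using h)
  refine ⟨Equiv.ofBijective f (Finite.injective_iff_bijective.1 hf), ?_⟩
  simp [permWord, f]

open BinaryTree in
theorem countDesc_eq_card_trees (n k : ℕ) :
    countDesc n k = #{t ∈ treesOfNumNodesEq n | t.rightEdges = k} := by
  classical
  rw [countDesc, Nat.card_eq_fintype_card, Fintype.card_subtype,
    ← card_image_of_injective _ permWord_injective,
    ← card_image_of_injective {t ∈ treesOfNumNodesEq n | t.rightEdges = k}
      (f := fun t => word132 t 0) fun _ _ h => word132_injective 0 h]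
  congr 1
  ext l
  simp only [mem_image, mem_filter, mem_univ, true_and, mem_treesOfNumNodesEq]
  constructor
  · rintro ⟨p, ⟨hav, hd⟩, rfl⟩
    obtain ⟨t, ht, hw⟩ := exists_word132_eq n 0 (permWord p) (by simp [permWord])
      (nodup_permWord p) (by simp [mem_permWord]) ((avoids132_permWord p).2 hav)
    refine ⟨t, ⟨ht, ?_⟩, hw⟩
    rw [← numDescents_word132 t 0, hw, numDescents_permWord, hd]
  · rintro ⟨t, ⟨rfl, rfl⟩, rfl⟩
    obtain ⟨p, hp⟩ := exists_permWord_eq (length_word132 t 0) (nodup_word132 t 0) (by simp)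
    refine ⟨p, ⟨?_, ?_⟩, hp⟩
    · rw [← avoids132_permWord, hp]
      exact avoids132_word132 t 0
    · rw [← numDescents_permWord, hp, numDescents_word132]

/-- The polynomials that are sums of polynomials `X ^ j * (1 + X) ^ i` with `2 * j + i = m`. -/
noncomputable def gammaCone (m : ℕ) : AddSubmonoid ℕ[X] :=
  AddSubmonoid.closure {p | ∃ j i, 2 * j + i = m ∧ p = X ^ j * (1 + X) ^ i}

namespace gammaCone

theorem X_pow_mul_mem (j i : ℕ) : (X ^ j * (1 + X) ^ i : ℕ[X]) ∈ gammaCone (2 * j + i) :=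
  AddSubmonoid.subset_closure ⟨j, i, rfl, rfl⟩

theorem mul_mem {a b : ℕ} {p q : ℕ[X]} (hp : p ∈ gammaCone a) (hq : q ∈ gammaCone b) :
    p * q ∈ gammaCone (a + b) := by
  induction hp using AddSubmonoid.closure_induction with
  | mem x hx =>
    obtain ⟨j, i, rfl, rfl⟩ := hx
    induction hq using AddSubmonoid.closure_induction with
    | mem y hy =>
      obtain ⟨j', i', rfl, rfl⟩ := hy
      have hprod : (X ^ j * (1 + X) ^ i * (X ^ j' * (1 + X) ^ i') : ℕ[X]) =
          X ^ (j + j') * (1 + X) ^ (i + i') := by ring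
      rw [hprod, show 2 * j + i + (2 * j' + i') = 2 * (j + j') + (i + i') by ring]
      exact X_pow_mul_mem _ _
    | zero => simp
    | add y z _ _ hy hz => rw [mul_add]; exact add_mem hy hz
  | zero => simp
  | add x y _ _ hx hy => rw [add_mul]; exact add_mem hx hy

theorem coeff_le_coeff_succ {m k : ℕ} {p : ℕ[X]} (hp : p ∈ gammaCone m) (hk : 2 * k + 1 ≤ m) :
    p.coeff k ≤ p.coeff (k + 1) := by
  induction hp using AddSubmonoid.closure_induction with
  | mem x hx =>
    obtain ⟨j, i, rfl, rfl⟩ := hx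
    simp only [coeff_X_pow_mul', coeff_one_add_X_pow, Nat.cast_id]
    by_cases hjk : j ≤ k
    · obtain ⟨r, rfl⟩ := Nat.exists_eq_add_of_le hjk
      rw [if_pos hjk, if_pos (by omega), Nat.add_sub_cancel_left, add_assoc,
        Nat.add_sub_cancel_left]
      refine Nat.le_of_mul_le_mul_right ?_ r.succ_pos
      rw [Nat.succ_eq_add_one, Nat.choose_succ_right_eq]
      exact Nat.mul_le_mul_left _ (by omega)
    · simp [hjk]
  | zero => simp
  | add x y _ _ hx hy => simpa using add_le_add hx hy

theorem coeff_succ_le_coeff {m k : ℕ} {p : ℕ[X]} (hp : p ∈ gammaCone m) (hk : m ≤ 2 * k + 1) :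
    p.coeff (k + 1) ≤ p.coeff k := by
  induction hp using AddSubmonoid.closure_induction with
  | mem x hx =>
    obtain ⟨j, i, rfl, rfl⟩ := hx
    simp only [coeff_X_pow_mul', coeff_one_add_X_pow, Nat.cast_id]
    obtain ⟨r, rfl⟩ := Nat.exists_eq_add_of_le (show j ≤ k by omega)
    rw [if_pos (by omega), if_pos (by omega), Nat.add_sub_cancel_left, add_assoc,
      Nat.add_sub_cancel_left]
    refine Nat.le_of_mul_le_mul_right ?_ r.succ_pos
    rw [Nat.succ_eq_add_one, Nat.choose_succ_right_eq]
    exact Nat.mul_le_mul_left _ (by omega)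
  | zero => simp
  | add x y _ _ hx hy => simpa using add_le_add hx hy

end gammaCone

namespace BinaryTree

/-- The generating polynomial of binary trees with `n` nodes by number of right edges. -/
noncomputable def rightEdgePoly (n : ℕ) : ℕ[X] := ∑ t ∈ treesOfNumNodesEq n, X ^ t.rightEdges

theorem coeff_rightEdgePoly (n k : ℕ) :
    (rightEdgePoly n).coeff k = #{t ∈ treesOfNumNodesEq n | t.rightEdges = k} := by
  simp_rw [rightEdgePoly, finsetSum_coeff, coeff_X_pow, card_filter, eq_comm]

theorem rightEdgePoly_zero : rightEdgePoly 0 = 1 := by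
  simp [rightEdgePoly, rightEdges]

theorem rightEdgePoly_succ (n : ℕ) :
    rightEdgePoly (n + 1) = ∑ ij ∈ antidiagonal n,
      rightEdgePoly ij.1 * rightEdgePoly ij.2 * if ij.2 = 0 then 1 else X := by
  rw [rightEdgePoly, treesOfNumNodesEq_succ, sum_biUnion]
  · refine sum_congr rfl fun ij _ => ?_
    rw [sum_map, rightEdgePoly, rightEdgePoly, sum_mul_sum, ← sum_product', sum_mul]
    refine sum_congr rfl fun t ht => ?_
    simp only [mem_product, mem_treesOfNumNodesEq] at ht
    change X ^ rightEdges (node () t.1 t.2) = _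
    simp only [rightEdges, ht.2, pow_add]
    split_ifs <;> simp
  · simp only [Set.PairwiseDisjoint, Set.Pairwise, Function.onFun, Finset.disjoint_left]
    aesop

theorem rightEdgePoly_succ_mem (n : ℕ) : rightEdgePoly (n + 1) ∈ gammaCone n := by
  have hX : (X : ℕ[X]) ∈ gammaCone 2 := by simpa using gammaCone.X_pow_mul_mem 1 0
  have hX1 : (1 + X : ℕ[X]) ∈ gammaCone 1 := by simpa using gammaCone.X_pow_mul_mem 0 1
  have h1 : rightEdgePoly 1 = 1 := by simp [rightEdgePoly_succ, rightEdgePoly_zero]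
  induction n using Nat.strong_induction_on with
  | _ n ih =>
    match n with
    | 0 => simpa [h1] using gammaCone.X_pow_mul_mem 0 0
    | 1 =>
      rw [rightEdgePoly_succ]
      simpa [Nat.antidiagonal_succ, rightEdgePoly_zero, h1, add_comm] using hX1
    | n + 2 =>
      rw [rightEdgePoly_succ, Nat.antidiagonal_succ_succ']
      simp only [sum_cons, sum_map, rightEdgePoly_zero]
      rw [← add_assoc]
      refine add_mem ?_ (sum_mem fun ij hij => ?_)
      · have hsum := gammaCone.mul_mem (ih (n + 1) (by omega)) hX1
        rw [mul_add, mul_one, add_comm (rightEdgePoly _)] at hsum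
        simpa using hsum
      · rw [HasAntidiagonal.mem_antidiagonal] at hij
        have := gammaCone.mul_mem
          (gammaCone.mul_mem (ih ij.1 (by omega)) (ih ij.2 (by omega))) hX
        simpa [hij] using this

end BinaryTree

/-- The sequence `a_0, …, a_{n-1}`, where `a_k` is the number of
132-avoiding permutations of `[n]` with exactly `k` descents, is unimodal. -/
theorem stmt_5 (n : ℕ) (hn : 0 < n) :
    ∃ m, m ≤ n - 1 ∧
      (∀ i j, i ≤ j → j ≤ m → countDesc n i ≤ countDesc n j) ∧
      (∀ i j, m ≤ i → i ≤ j → j ≤ n - 1 → countDesc n j ≤ countDesc n i) := by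
  obtain ⟨n, rfl⟩ := Nat.exists_eq_add_of_le' hn
  have hmem := BinaryTree.rightEdgePoly_succ_mem n
  simp only [countDesc_eq_card_trees, ← BinaryTree.coeff_rightEdgePoly, Nat.add_sub_cancel]
  refine ⟨n / 2, by omega, fun i j hij hj => ?_, fun i j hi hij _ => ?_⟩
  · induction j, hij using Nat.le_induction with
    | base => exact le_rfl
    | succ j _ ih =>
      exact (ih (by omega)).trans (gammaCone.coeff_le_coeff_succ hmem (by omega))
  · induction j, hij using Nat.le_induction with
    | base => exact le_rfl
    | succ j _ ih =>
      exact (gammaCone.coeff_succ_le_coeff hmem (by omega)).trans (ih (by omega))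
end

section
/- For every positive integer n and every positive integer k, the poset P_n of 132-avoiding permutations of [n] ordered by containment of descent sets is k-Sperner: every subset A of 132-avoiding permutations of [n] containing no chain of k+1 elements (i.e., no x_0, x_1, ..., x_k in A with D(x_0) ⊊ D(x_1) ⊊ ... ⊊ D(x_k)) satisfies |A| ≤ the sum of the k largest values among a_0, a_1, ..., a_{n-1}, where a_j is the number of 132-avoiding permutations of [n] with exactly j descents. -/
namespace SymmetricChain

variable {α : Type*} (R : α → α → Prop) (rk : α → ℕ)

/-- A list that is increasing for `R`, whose ranks are consecutive integers
placed symmetrically in `{0, …, N}`. -/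
def IsSymChain (N : ℕ) (c : List α) : Prop :=
  c.Pairwise R ∧ ∃ r, 2 * r + c.length = N + 1 ∧ c.map rk = List.range' r c.length

/-- A multiset that is a sum of symmetric chains. -/
inductive Decomposes (N : ℕ) : Multiset α → Prop
  | zero : Decomposes N 0
  | add {c : List α} {M : Multiset α} :
      IsSymChain R rk N c → Decomposes N M → Decomposes N (↑c + M)

variable {R rk}

theorem Decomposes.union {N : ℕ} {M M' : Multiset α} (h : Decomposes R rk N M)
    (h' : Decomposes R rk N M') : Decomposes R rk N (M + M') := by
  induction h with
  | zero => simpa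
  | add hc _ ih => rw [add_assoc]; exact .add hc ih

theorem Decomposes.sum {ι : Type*} {N : ℕ} {s : Finset ι} {M : ι → Multiset α}
    (h : ∀ i ∈ s, Decomposes R rk N (M i)) : Decomposes R rk N (∑ i ∈ s, M i) := by
  induction s using Finset.cons_induction with
  | empty => exact .zero
  | cons i s hi ih =>
    rw [Finset.sum_cons]
    exact (h i (by simp)).union (ih fun j hj => h j (by simp [hj]))

theorem IsSymChain.decomposes {N : ℕ} {c : List α} (h : IsSymChain R rk N c) :
    Decomposes R rk N (c : Multiset α) := by
  simpa using Decomposes.add h .zero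

/-- The product of two saturated chains is a sum of symmetric chains, by peeling off hooks. -/
theorem decomposes_bind_chain [Std.Refl R] {g : α → α → α} {e N : ℕ}
    (hR : ∀ x x' y y', R x x' → R y y' → R (g x y) (g x' y'))
    (hrk : ∀ x y, rk (g x y) = rk x + rk y + e) (c c' : List α) {r s : ℕ}
    (hc : c.Pairwise R) (hcr : c.map rk = List.range' r c.length)
    (hc' : c'.Pairwise R) (hcs : c'.map rk = List.range' s c'.length)
    (hN : 2 * (r + s + e) + c.length + c'.length = N + 2) :
    Decomposes R rk N ((c : Multiset α).bind fun x => (c' : Multiset α).map (g x)) := by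
  induction c generalizing c' r with
  | nil => exact .zero
  | cons x xs ih =>
    rcases List.eq_nil_or_concat c' with rfl | ⟨ys, y, rfl⟩
    · simpa using Decomposes.zero
    rw [List.concat_eq_append] at *
    have hsplit : ((x :: xs : List α) : Multiset α).bind
          (fun x => ((ys ++ [y] : List α) : Multiset α).map (g x)) =
        (((ys ++ [y]).map (g x) ++ xs.map (g · y) : List α) : Multiset α) +
          (xs : Multiset α).bind fun x => (ys : Multiset α).map (g x) := by
      rw [← Multiset.cons_coe, Multiset.cons_bind, ← Multiset.coe_add, ← Multiset.coe_add,
        ← Multiset.map_coe, ← Multiset.map_coe]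
      simp only [Multiset.map_add, Multiset.bind_add, Multiset.coe_singleton,
        Multiset.map_singleton, Multiset.bind_singleton, ← Multiset.coe_add]
      abel
    simp only [List.length_cons, List.length_append, List.length_nil, List.map_cons,
      List.range'_succ, List.cons.injEq] at hcr hN
    rw [List.map_append, List.length_append, ← List.range'_append_1] at hcs
    obtain ⟨hys, hy⟩ := List.append_inj hcs (by simp)
    simp only [List.map_cons, List.map_nil, List.length_singleton, List.range'_one, List.cons.injEq,
      and_true] at hy
    rw [hsplit]
    rw [List.pairwise_cons] at hc
    have hcr1 : xs.map rk = List.range' (r + 1) xs.length := hcr.2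
    refine .add ⟨?_, r + s + e, ?_, ?_⟩ (ih ys hc.2 hcr1 (List.pairwise_append.1 hc').1 hys ?_)
    · rw [List.pairwise_append]
      refine ⟨?_, ?_, ?_⟩
      · exact hc'.map _ fun a b h => hR _ _ _ _ (Std.Refl.refl x) h
      · exact hc.2.map _ fun a b h => hR _ _ _ _ h (Std.Refl.refl y)
      · simp only [List.mem_map]
        rintro _ ⟨a, ha, rfl⟩ _ ⟨b, hb, rfl⟩
        refine hR _ _ _ _ (hc.1 b hb) ?_
        rcases List.mem_append.1 ha with ha | ha
        · exact (List.pairwise_append.1 hc').2.2 a ha y (by simp)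
        · rw [List.mem_singleton.1 ha]; exact Std.Refl.refl y
    · simp; omega
    · have h1 : ∀ l : List α, (l.map (g x)).map rk = (l.map rk).map ((rk x + e) + ·) := by
        intro l; simp [hrk]; intros; ring
      have h2 : ∀ l : List α, (l.map (g · y)).map rk = (l.map rk).map ((rk y + e) + ·) := by
        intro l; simp [hrk]; intros; ring
      rw [List.map_append, h1, h2, List.map_append, hys, hcr1]
      simp only [List.map_cons, List.map_nil, hy, hcr.1, List.length_append, List.length_map,
        List.length_cons, List.length_nil, List.map_add_range', List.map_append]
      rw [← List.range'_append_1, ← List.range'_append_1]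
      simp only [zero_add, List.range'_one]
      congr! 2
      · congr 1; omega
      · congr 1; omega
      · omega
    · omega

theorem Decomposes.bind [Std.Refl R] {g : α → α → α} {e N N' K : ℕ}
    (hR : ∀ x x' y y', R x x' → R y y' → R (g x y) (g x' y'))
    (hrk : ∀ x y, rk (g x y) = rk x + rk y + e) {M M' : Multiset α}
    (h : Decomposes R rk N M) (h' : Decomposes R rk N' M') (hK : N + N' + 2 * e = K) :
    Decomposes R rk K (M.bind fun x => M'.map (g x)) := by
  induction h with
  | zero => exact .zero
  | @add c M hc _ ih =>
    rw [Multiset.add_bind]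
    refine Decomposes.union ?_ ih
    clear ih
    induction h' with
    | zero => simpa using Decomposes.zero
    | @add c' M' hc' _ ih' =>
      simp only [Multiset.map_add, Multiset.bind_add]
      refine Decomposes.union ?_ ih'
      obtain ⟨hp, r, hr, hcr⟩ := hc
      obtain ⟨hp', s, hs, hcs⟩ := hc'
      exact decomposes_bind_chain hR hrk c c' hp hcr hp' hcs (by omega)

theorem min_le_countP_range' {N k r l : ℕ} (hk : k ≤ N + 1) (h : 2 * r + l = N + 1) :
    min k l ≤ (List.range' r l).countP
      (· ∈ Finset.Ico ((N + 1 - k) / 2) ((N + 1 - k) / 2 + k)) := by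
  have h1 : ((Finset.Ico r (r + l)).filter
      (· ∈ Finset.Ico ((N + 1 - k) / 2) ((N + 1 - k) / 2 + k))).card =
      (List.range' r l).countP (· ∈ Finset.Ico ((N + 1 - k) / 2) ((N + 1 - k) / 2 + k)) := by
    rw [List.countP_eq_length_filter]
    have : (Finset.Ico r (r + l)).val = (List.range' r l : Multiset ℕ) := by
      change ((List.range' r (r + l - r) : List ℕ) : Multiset ℕ) = _
      simp
    rw [Finset.card, Finset.filter_val, this]
    simp
  rw [← h1, Finset.filter_mem_eq_inter, Finset.Ico_inter_Ico, Nat.card_Ico]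
  omega

theorem IsSymChain.card_le {N k : ℕ} {c : List α} {B : Multiset α} (h : IsSymChain R rk N c)
    (hB : B ≤ c) (hchain : ¬ ∃ c : Fin (k + 1) → α,
      (∀ i, c i ∈ B) ∧ ∀ i j, i < j → R (c i) (c j) ∧ rk (c i) < rk (c j)) :
    Multiset.card B ≤ c.countP (fun x => rk x ∈ Finset.Ico ((N + 1 - min k (N + 1)) / 2)
      ((N + 1 - min k (N + 1)) / 2 + min k (N + 1))) := by
  obtain ⟨hp, r, hr, hcr⟩ := h
  induction B using Quotient.inductionOn with
  | h B =>
  obtain ⟨l, hl, hlc⟩ := Multiset.coe_le.1 hB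
  have hrank : (c.map rk).Pairwise (· < ·) := hcr ▸ List.pairwise_lt_range' 1
  have hlen : l.length ≤ k := by
    by_contra! hlt
    refine hchain ⟨fun i => l[i.1]'(by omega), fun i => ?_, fun i j hij => ⟨?_, ?_⟩⟩
    · exact hl.subset (List.getElem_mem _)
    · exact List.pairwise_iff_getElem.1 (hp.sublist hlc) _ _ _ _ hij
    · exact List.pairwise_iff_getElem.1 ((List.pairwise_map.1 hrank).sublist hlc) _ _ _ _ hij
  have hmin := min_le_countP_range' (N := N) (k := min k (N + 1)) (r := r) (l := c.length)
    (by omega) hr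
  rw [← hcr, List.countP_map] at hmin
  have := hlc.length_le
  change B.length ≤ _
  rw [← hl.length_eq]
  refine le_trans ?_ hmin
  omega

/-- A multiset decomposed into symmetric chains has the strong Sperner property. -/
theorem Decomposes.card_le {N k : ℕ} {M B : Multiset α} (h : Decomposes R rk N M)
    (hB : B ≤ M) (hchain : ¬ ∃ c : Fin (k + 1) → α,
      (∀ i, c i ∈ B) ∧ ∀ i j, i < j → R (c i) (c j) ∧ rk (c i) < rk (c j)) :
    Multiset.card B ≤ M.countP (fun x => rk x ∈ Finset.Ico ((N + 1 - min k (N + 1)) / 2)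
      ((N + 1 - min k (N + 1)) / 2 + min k (N + 1))) := by
  classical
  induction h generalizing B with
  | zero => simp_all
  | @add c M hc _ ih =>
    rw [← Multiset.sub_add_inter B c, Multiset.card_add, Multiset.countP_add, add_comm]
    refine add_le_add ?_ (ih (Multiset.sub_le_iff_le_add'.2 hB) ?_)
    · refine hc.card_le Multiset.inter_le_right ?_
      rintro ⟨d, hd, hd'⟩
      exact hchain ⟨d, fun i => Multiset.mem_of_le Multiset.inter_le_left (hd i), hd'⟩
    · rintro ⟨d, hd, hd'⟩
      exact hchain ⟨d, fun i => Multiset.mem_of_le (Multiset.sub_le_self _ _) (hd i), hd'⟩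

end SymmetricChain

namespace DescentTree

open BinaryTree

/-- The list of letters `b` (ascent or descent) next to a possibly empty subtree. -/
def tag (b : Bool) : BinaryTree Unit → List Bool
  | .nil => []
  | .node _ _ _ => [b]

/-- The ascent-descent word of the permutation `L n R` attached to a tree `(L, R)`;
`true` stands for a descent. -/
def peakWord : BinaryTree Unit → List Bool
  | .nil => []
  | .node _ l r => peakWord l ++ (tag false l ++ (tag true r ++ peakWord r))

/-- The word `D l A r` attached to a tree `(l, r)`, letters next to empty subtrees being omitted. -/
def firstWord : BinaryTree Unit → List Bool
  | .nil => []
  | .node _ l r => tag true l ++ (firstWord l ++ (tag false r ++ firstWord r))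

/-- Attach a node with right subtree `s` at the bottom of the left spine of a tree. -/
def insertLeft : BinaryTree Unit → BinaryTree Unit → BinaryTree Unit
  | .nil, s => .node () .nil s
  | .node _ l r, s => .node () (insertLeft l s) r

/-- The bijection on trees carrying `firstWord` to `peakWord`. -/
def rotate : BinaryTree Unit → BinaryTree Unit
  | .nil => .nil
  | .node _ l r => insertLeft (rotate r) (rotate l)

theorem tag_nil (b : Bool) : tag b .nil = [] := rfl

theorem insertLeft_ne_nil (t s : BinaryTree Unit) : insertLeft t s ≠ .nil := by
  cases t <;> simp [insertLeft]

theorem insertLeft_inj {t t' s s' : BinaryTree Unit} (h : insertLeft t s = insertLeft t' s') :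
    t = t' ∧ s = s' := by
  induction t generalizing t' with
  | nil =>
    cases t' with
    | nil => simpa [insertLeft] using h
    | node _ l r =>
      simp only [insertLeft, node.injEq, true_and] at h
      exact absurd h.1.symm (insertLeft_ne_nil _ _)
  | node _ l r ih =>
    cases t' with
    | nil =>
      simp only [insertLeft, node.injEq, true_and] at h
      exact absurd h.1 (insertLeft_ne_nil _ _)
    | node _ l' r' =>
      simp only [insertLeft, node.injEq, true_and] at h
      obtain ⟨rfl, rfl⟩ := ih h.1
      simp [h.2]

theorem numNodes_insertLeft (t s : BinaryTree Unit) :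
    (insertLeft t s).numNodes = t.numNodes + s.numNodes + 1 := by
  induction t with
  | nil => simp [insertLeft]
  | node _ l r ih => simp only [insertLeft, numNodes, ih]; omega

theorem tag_insertLeft (b : Bool) (t s : BinaryTree Unit) : tag b (insertLeft t s) = [b] := by
  cases t <;> rfl

theorem peakWord_insertLeft (t s : BinaryTree Unit) :
    peakWord (insertLeft t s) = tag true s ++ (peakWord s ++ (tag false t ++ peakWord t)) := by
  induction t with
  | nil => simp [insertLeft, peakWord, tag]
  | node _ l r ih =>
    simp only [insertLeft, peakWord, ih, tag_insertLeft]
    cases l <;> simp [tag, peakWord]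

theorem numNodes_rotate (t : BinaryTree Unit) : (rotate t).numNodes = t.numNodes := by
  induction t with
  | nil => rfl
  | node _ l r ihl ihr => simp only [rotate, numNodes_insertLeft, ihl, ihr, numNodes]; omega

theorem rotate_injective : Function.Injective rotate := by
  intro t t' h
  induction t generalizing t' with
  | nil =>
    cases t' with
    | nil => rfl
    | node _ l r => exact absurd h.symm (insertLeft_ne_nil _ _)
  | node _ l r ihl ihr =>
    cases t' with
    | nil => exact absurd h (insertLeft_ne_nil _ _)
    | node _ l' r' =>
      obtain ⟨h1, h2⟩ := insertLeft_inj h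
      rw [ihl h2, ihr h1]

theorem tag_rotate (b : Bool) (t : BinaryTree Unit) : tag b (rotate t) = tag b t := by
  cases t with
  | nil => rfl
  | node _ l r => rw [rotate, tag_insertLeft]; rfl

theorem peakWord_rotate (t : BinaryTree Unit) : peakWord (rotate t) = firstWord t := by
  induction t with
  | nil => rfl
  | node _ l r ihl ihr =>
    simp only [rotate, peakWord_insertLeft, ihl, ihr, firstWord, tag_rotate]

theorem map_firstWord_eq_map_peakWord (n : ℕ) :
    (treesOfNumNodesEq n).val.map firstWord = (treesOfNumNodesEq n).val.map peakWord := by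
  have h : (treesOfNumNodesEq n).map ⟨rotate, rotate_injective⟩ = treesOfNumNodesEq n := by
    refine Finset.eq_of_subset_of_card_le (fun t ht => ?_) (by simp)
    obtain ⟨s, hs, rfl⟩ := Finset.mem_map.1 ht
    rw [mem_treesOfNumNodesEq] at hs ⊢
    rw [← hs]
    exact numNodes_rotate s
  conv_rhs => rw [← h]
  simp [peakWord_rotate]

/-- The order on ascent-descent words: containment of the descents. -/
def WordLE : List Bool → List Bool → Prop := List.Forall₂ (· ≤ ·)

/-- The number of descents of a word. -/
abbrev rank (w : List Bool) : ℕ := w.count true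

open SymmetricChain

theorem WordLE.append {u u' v v' : List Bool} (h : WordLE u u') (h' : WordLE v v') :
    WordLE (u ++ v) (u' ++ v') := List.rel_append h h'

instance : Std.Refl WordLE := ⟨List.forall₂_refl⟩

theorem decomposes_singleton_nil : Decomposes WordLE rank 0 {([] : List Bool)} :=
  IsSymChain.decomposes (c := [[]]) ⟨by simp, 0, by simp⟩

theorem decomposes_letter : Decomposes WordLE rank 1 ({[false], [true]} : Multiset (List Bool)) :=
  IsSymChain.decomposes (c := [[false], [true]]) ⟨by simp [WordLE], 0, by simp [rank, List.range']⟩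

theorem map_firstWord_succ (n : ℕ) :
    (treesOfNumNodesEq (n + 1)).val.map firstWord =
      ∑ ij ∈ Finset.HasAntidiagonal.antidiagonal n, (treesOfNumNodesEq ij.1).val.bind fun l =>
        (treesOfNumNodesEq ij.2).val.map fun r => firstWord (.node () l r) := by
  have key (s : Finset (BinaryTree Unit)) (f : BinaryTree Unit → List Bool) :
      s.val.map f = ∑ t ∈ s, ({f t} : Multiset (List Bool)) := by
    rw [Finset.sum, ← Multiset.sum_map_singleton (Multiset.map _ _), Multiset.map_map]
    rfl
  rw [key, treesOfNumNodesEq_succ, Finset.sum_biUnion]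
  · refine Finset.sum_congr rfl fun ij _ => ?_
    rw [Finset.sum_map, Finset.sum_product]
    change _ = ∑ l ∈ treesOfNumNodesEq ij.1, _
    refine Finset.sum_congr rfl fun l _ => ?_
    exact (key _ _).symm
  · intro i _ j _ hij
    refine Finset.disjoint_left.2 fun t hi hj => hij ?_
    obtain ⟨⟨a, b⟩, hab, rfl⟩ := Finset.mem_map.1 hi
    obtain ⟨⟨a', b'⟩, hab', he⟩ := Finset.mem_map.1 hj
    obtain ⟨rfl, rfl⟩ : a' = a ∧ b' = b := by simpa using he
    simp only [Finset.mem_product, mem_treesOfNumNodesEq] at hab hab'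
    exact Prod.ext (hab.1.symm.trans hab'.1) (hab.2.symm.trans hab'.2)

theorem tag_of_mem {n : ℕ} {t : BinaryTree Unit} (ht : t ∈ treesOfNumNodesEq (n + 1)) (b : Bool) :
    tag b t = [b] := by
  cases t with
  | nil => simp [mem_treesOfNumNodesEq] at ht
  | node => rfl

theorem decomposes_firstWord (n : ℕ) :
    Decomposes WordLE rank (n - 1) ((treesOfNumNodesEq n).val.map firstWord) := by
  induction n using Nat.strong_induction_on with
  | _ n ih =>
  match n with
  | 0 => simpa [firstWord] using decomposes_singleton_nil
  | 1 => simpa [map_firstWord_succ, firstWord, tag] using decomposes_singleton_nil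
  | m + 2 =>
    have hends : Decomposes WordLE rank (m + 1)
        (((treesOfNumNodesEq 0).val.bind fun l =>
          (treesOfNumNodesEq (m + 1)).val.map fun r => firstWord (.node () l r)) +
        ((treesOfNumNodesEq (m + 1)).val.bind fun l =>
          (treesOfNumNodesEq 0).val.map fun r => firstWord (.node () l r))) := by
      have h := decomposes_letter.bind (g := (· ++ ·)) (e := 0) (K := m + 1)
        (fun _ _ _ _ => WordLE.append) (by simp [rank]) (ih (m + 1) (by omega)) (by simp; omega)
      convert h using 1
      simp only [treesOfNumNodesEq_zero, Finset.singleton_val, Multiset.singleton_bind,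
        Multiset.map_singleton, Multiset.insert_eq_cons, Multiset.cons_bind, Multiset.map_map,
        Multiset.bind_singleton]
      congr 1
      · refine Multiset.map_congr rfl fun t ht => ?_
        simp [firstWord, tag_of_mem ht, tag_nil]
      · refine Multiset.map_congr rfl fun t ht => ?_
        simp [firstWord, tag_of_mem ht, tag_nil]
    have hmid (i j : ℕ) (hij : i + j + 1 = m) : Decomposes WordLE rank (m + 1)
        ((treesOfNumNodesEq (i + 1)).val.bind fun l =>
          (treesOfNumNodesEq (j + 1)).val.map fun r => firstWord (.node () l r)) := by
      have h := (ih (i + 1) (by omega)).bind (g := fun u v => true :: u ++ false :: v) (e := 1)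
        (K := m + 1)
        (fun _ _ _ _ h h' => WordLE.append (.cons le_rfl h) (.cons le_rfl h'))
        (fun u v => by simp [rank]) (ih (j + 1) (by omega)) (by omega)
      convert h using 1
      rw [Multiset.bind_map]
      refine Multiset.bind_congr fun l hl => ?_
      rw [Multiset.map_map]
      refine Multiset.map_congr rfl fun r hr => ?_
      simp [firstWord, tag_of_mem hl, tag_of_mem hr]
    rw [map_firstWord_succ]
    match m with
    | 0 => simpa [Finset.Nat.antidiagonal_succ] using hends
    | m + 1 =>
      rw [Finset.Nat.antidiagonal_succ_succ', Finset.sum_cons, Finset.sum_cons, ← add_assoc,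
        Finset.sum_map]
      refine hends.union (Decomposes.sum fun ij hij => hmid _ _ ?_)
      rw [Finset.HasAntidiagonal.mem_antidiagonal.1 hij]

theorem decomposes_peakWord (n : ℕ) :
    Decomposes WordLE rank (n - 1) ((treesOfNumNodesEq n).val.map peakWord) :=
  map_firstWord_eq_map_peakWord n ▸ decomposes_firstWord n

/-- The ascent-descent word of a list of numbers; `true` stands for a descent. -/
def descentWord : List ℕ → List Bool
  | a :: b :: l => decide (b < a) :: descentWord (b :: l)
  | _ => []

theorem length_descentWord (l : List ℕ) : (descentWord l).length = l.length - 1 := by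
  induction l using descentWord.induct with
  | case1 a b l ih => simp [descentWord, ih]
  | case2 l h =>
    match l with
    | [] => rfl
    | [a] => rfl
    | a :: b :: l => exact absurd rfl (h a b l)

theorem getElem_descentWord (l : List ℕ) (i : ℕ) (h : i + 1 < l.length) :
    (descentWord l)[i]'(by rw [length_descentWord]; omega) = decide (l[i + 1] < l[i]) := by
  induction l using descentWord.induct generalizing i with
  | case1 a b l ih =>
    cases i with
    | zero => simp [descentWord]
    | succ i =>
      simp only [descentWord]
      exact ih i (by simpa using h)
  | case2 l hl =>
    match l with
    | [] => simp at h
    | [a] => simp at h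
    | a :: b :: l => exact absurd rfl (hl a b l)

/-- The list of values of the 132-avoiding permutation attached to a tree,
with smallest value `c`. -/
def values : BinaryTree Unit → ℕ → List ℕ
  | .nil, _ => []
  | .node _ l r, c =>
    values l (c + r.numNodes) ++ (c + l.numNodes + r.numNodes) :: values r c

theorem length_values (t : BinaryTree Unit) (c : ℕ) : (values t c).length = t.numNodes := by
  induction t generalizing c with
  | nil => rfl
  | node _ l r ihl ihr => simp [values, ihl, ihr]; omega

theorem mem_values {t : BinaryTree Unit} {c x : ℕ} (h : x ∈ values t c) :
    c ≤ x ∧ x < c + t.numNodes := by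
  induction t generalizing c with
  | nil => simp [values] at h
  | node _ l r ihl ihr =>
    simp only [values, List.mem_append, List.mem_cons] at h
    simp only [numNodes]
    rcases h with h | h | h
    · have := ihl h; omega
    · omega
    · have := ihr h; omega

theorem nodup_values (t : BinaryTree Unit) (c : ℕ) : (values t c).Nodup := by
  induction t generalizing c with
  | nil => simp [values]
  | node _ l r ihl ihr =>
    rw [values, List.nodup_append', List.nodup_cons]
    refine ⟨ihl _, ⟨fun h => ?_, ihr _⟩, fun x hx hx' => ?_⟩
    · have := mem_values h; omega
    · have h1 := mem_values hx
      rcases List.mem_cons.1 hx' with rfl | hx'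
      · omega
      · have := mem_values hx'; omega

theorem values_injective (c : ℕ) : Function.Injective (values · c) := by
  intro t t' h
  have hlen : t.numNodes = t'.numNodes := by
    rw [← length_values t c, ← length_values t' c]; exact congrArg _ h
  induction t generalizing t' c with
  | nil =>
    cases t' with
    | nil => rfl
    | node => simp at hlen
  | node _ l r ihl ihr =>
    cases t' with
    | nil => simp at hlen
    | node _ l' r' =>
      simp only [numNodes] at hlen
      simp only [values] at h
      have hm : c + l.numNodes + r.numNodes = c + l'.numNodes + r'.numNodes := by omega
      rw [← hm, List.append_cons_inj_of_notMem] at h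
      · have hl : l.numNodes = l'.numNodes := by
          rw [← length_values l (c + r.numNodes), h.1, length_values]
        have hr : r.numNodes = r'.numNodes := by omega
        rw [hr] at h
        rw [ihl _ h.1 hl, ihr _ h.2.2 hr]
      · intro hx; have := mem_values hx; omega
      · intro hx; have := mem_values hx; omega

theorem descentWord_append_cons {l r : List ℕ} {m : ℕ} (hl : ∀ x ∈ l, x < m)
    (hr : ∀ x ∈ r, x < m) :
    descentWord (l ++ m :: r) = descentWord l ++ ((if l = [] then [] else [false]) ++
      ((if r = [] then [] else [true]) ++ descentWord r)) := by
  induction l with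
  | nil =>
    cases r with
    | nil => simp [descentWord]
    | cons b r => simp_all [descentWord]
  | cons a l ih =>
    specialize ih fun x hx => hl x (by simp [hx])
    cases l with
    | nil =>
      have := hl a (by simp)
      simp_all [descentWord, this.le]
    | cons b l => simpa [descentWord] using ih

theorem tag_eq_ite (b : Bool) (t : BinaryTree Unit) (c : ℕ) :
    tag b t = if values t c = [] then [] else [b] := by
  cases t <;> simp [tag, values]

theorem descentWord_values (t : BinaryTree Unit) (c : ℕ) :
    descentWord (values t c) = peakWord t := by
  induction t generalizing c with
  | nil => rfl
  | node _ l r ihl ihr =>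
    rw [values, descentWord_append_cons, ihl, ihr, ← tag_eq_ite, ← tag_eq_ite, peakWord]
    · intro x hx; have := mem_values hx; omega
    · intro x hx; have := mem_values hx; omega

/-- A list is 132-avoiding if no three entries of it form the pattern 132. -/
def ListAvoids132 (l : List ℕ) : Prop :=
  ∀ a b d, [a, b, d].Sublist l → ¬ (a < d ∧ d < b)

theorem ListAvoids132.sublist {l l' : List ℕ} (h : ListAvoids132 l) (hl : l'.Sublist l) :
    ListAvoids132 l' := fun a b d hs => h a b d (hs.trans hl)

theorem listAvoids132_values (t : BinaryTree Unit) (c : ℕ) : ListAvoids132 (values t c) := by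
  induction t generalizing c with
  | nil => intro a b d h; simp [values] at h
  | node _ l r ihl ihr =>
    rintro a b d h ⟨had, hdb⟩
    have hb := mem_values (t := .node () l r) (h.subset (by simp : b ∈ [a, b, d]))
    simp only [numNodes] at hb
    rw [values, List.sublist_append_iff] at h
    obtain ⟨l₁, l₂, he, h₁, h₂⟩ := h
    have hd : d ∈ values r c ∨ l₂ = [] := by
      rcases List.eq_nil_or_concat l₂ with rfl | ⟨l₃, d', rfl⟩
      · exact .inr rfl
      · left
        have hd' : d = d' := by
          have := congrArg List.getLast? he
          simpa [List.concat_eq_append] using this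
        subst hd'
        have := h₂.subset (by simp : d ∈ l₃.concat d)
        rcases List.mem_cons.1 this with rfl | h
        · omega
        · exact h
    rcases hd with hd | rfl
    · have hd1 := mem_values hd
      cases l₁ with
      | nil =>
        rw [List.nil_append] at he
        subst he
        rw [List.sublist_cons_iff] at h₂
        rcases h₂ with h₂ | ⟨_, h₂, _⟩
        · exact ihr c a b d h₂ ⟨had, hdb⟩
        · simp only [List.cons.injEq] at h₂
          omega
      | cons x l₁ =>
        simp only [List.cons_append, List.cons.injEq] at he
        have := mem_values (h₁.subset (by simp : x ∈ x :: l₁))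
        omega
    · rw [List.append_nil] at he
      subst he
      exact ihl _ a b d h₁ ⟨had, hdb⟩

theorem exists_values_eq (n c : ℕ) (l : List ℕ) (hl : l.Perm (List.range' c n))
    (h : ListAvoids132 l) : ∃ t, values t c = l := by
  induction n using Nat.strong_induction_on generalizing c l with
  | _ n ih =>
  cases n with
  | zero => exact ⟨.nil, by simpa [values, eq_comm] using hl⟩
  | succ n =>
    obtain ⟨L, R, rfl⟩ := List.append_of_mem
      (hl.mem_iff.2 (by simp : c + n ∈ List.range' c (n + 1)))
    have hperm : (L ++ R).Perm (List.range' c n) := by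
      have := List.perm_middle.symm.trans hl
      rw [List.range'_1_concat] at this
      exact (this.trans (List.perm_append_singleton _ _)).cons_inv
    have hlen : L.length + R.length = n := by simpa using hperm.length_eq
    have hnd : (L ++ R).Nodup := hperm.nodup_iff.2 (List.nodup_range' 1)
    have hlt : ∀ b ∈ R, ∀ a ∈ L, b ≤ a := by
      intro b hb a ha
      by_contra! hab
      refine h a (c + n) b ?_ ⟨hab, ?_⟩
      · exact (List.singleton_sublist.2 ha).append
          ((List.singleton_sublist.2 hb).cons_cons _)
      · have := hperm.subset (List.mem_append_right L hb)
        simp only [List.mem_range'_1] at this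
        omega
    have hsort : R.insertionSort (· ≤ ·) ++ L.insertionSort (· ≤ ·) =
        List.range' c R.length ++ List.range' (c + R.length) L.length := by
      rw [List.range'_append_1, add_comm, hlen]
      refine List.Perm.eq_of_pairwise (le := (· ≤ ·)) (fun a b _ _ => le_antisymm) ?_ ?_ ?_
      · rw [List.pairwise_append]
        refine ⟨List.pairwise_insertionSort _ _, List.pairwise_insertionSort _ _, ?_⟩
        intro b hb a ha
        exact hlt b ((List.mem_insertionSort _).1 hb) a ((List.mem_insertionSort _).1 ha)
      · exact (List.pairwise_lt_range' 1).imp le_of_lt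
      · exact (((List.perm_insertionSort _ R).append (List.perm_insertionSort _ L)).trans
          List.perm_append_comm).trans hperm
    obtain ⟨hR, hL⟩ := List.append_inj hsort (by simp)
    obtain ⟨tL, htL⟩ := ih L.length (by omega) (c + R.length) L
      (hL ▸ (List.perm_insertionSort _ L).symm) (h.sublist (List.sublist_append_left _ _))
    obtain ⟨tR, htR⟩ := ih R.length (by omega) c R
      (hR ▸ (List.perm_insertionSort _ R).symm)
      (h.sublist ((List.sublist_cons_self _ _).trans (List.sublist_append_right _ _)))
    have hnL : tL.numNodes = L.length := by rw [← htL, length_values]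
    have hnR : tR.numNodes = R.length := by rw [← htR, length_values]
    refine ⟨.node () tL tR, ?_⟩
    rw [values, hnL, hnR, htL, htR, add_assoc, hlen]

/-- The ascent-descent word of a permutation. -/
def permWord {n : ℕ} (p : Equiv.Perm (Fin n)) : List Bool :=
  descentWord (List.ofFn fun i => (p i : ℕ))

theorem length_permWord {n : ℕ} (p : Equiv.Perm (Fin n)) : (permWord p).length = n - 1 := by
  rw [permWord, length_descentWord, List.length_ofFn]

theorem succ_mem_descentSet_iff {n : ℕ} (p : Equiv.Perm (Fin n)) (i : ℕ) :
    i + 1 ∈ DescentSet p ↔ (permWord p)[i]? = some true := by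
  by_cases hi : i + 1 < n
  · rw [List.getElem?_eq_getElem (by rw [length_permWord]; omega)]
    simp only [permWord]
    rw [getElem_descentWord _ _ (by simpa using hi)]
    simp [DescentSet, hi]
  · rw [List.getElem?_eq_none (by rw [length_permWord]; omega)]
    simp [DescentSet, hi]

theorem count_true_eq_card (w : List Bool) :
    w.count true = ((Finset.range w.length).filter fun i => w[i]? = some true).card := by
  induction w using List.reverseRecOn with
  | nil => simp
  | append_singleton w b ih =>
    have h : (Finset.range w.length).filter (fun i => (w ++ [b])[i]? = some true) =
        (Finset.range w.length).filter fun i => w[i]? = some true :=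
      Finset.filter_congr fun i hi => by
        rw [List.getElem?_append_left (Finset.mem_range.1 hi)]
    rw [List.count_append, ih, List.length_append, List.length_singleton, Finset.range_add_one,
      Finset.filter_insert, h]
    cases b <;> simp

theorem card_descentSet {n : ℕ} (p : Equiv.Perm (Fin n)) :
    (DescentSet p).card = rank (permWord p) := by
  rw [rank, count_true_eq_card,
    ← Finset.card_map (s := Finset.filter _ _) (addRightEmbedding 1)]
  congr 1
  ext i
  cases i with
  | zero => simp [DescentSet]
  | succ i =>
    rw [succ_mem_descentSet_iff]
    simp only [Finset.mem_map, Finset.mem_filter, Finset.mem_range, addRightEmbedding_apply,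
      Nat.add_right_cancel_iff, exists_eq_right, iff_and_self]
    intro h
    exact (List.getElem?_eq_some_iff.1 h).1

theorem descentSet_subset {n : ℕ} {p q : Equiv.Perm (Fin n)}
    (h : WordLE (permWord p) (permWord q)) : DescentSet p ⊆ DescentSet q := by
  intro i hi
  cases i with
  | zero => simp [DescentSet] at hi
  | succ i =>
    rw [succ_mem_descentSet_iff] at hi ⊢
    obtain ⟨hi, he⟩ := List.getElem?_eq_some_iff.1 hi
    obtain ⟨hlen, h⟩ := List.forall₂_iff_get.1 h
    have := h i hi (hlen ▸ hi)
    simp only [List.get_eq_getElem, he] at this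
    exact List.getElem?_eq_some_iff.2 ⟨hlen ▸ hi, top_le_iff.1 this⟩

theorem listAvoids132_ofFn_iff {n : ℕ} (p : Equiv.Perm (Fin n)) :
    ListAvoids132 (List.ofFn fun i => (p i : ℕ)) ↔ Avoids132 p := by
  constructor
  · rintro h ⟨i, j, k, hij, hjk, hik, hkj⟩
    refine h (p i) (p j) (p k) ?_ ⟨hik, hkj⟩
    have hs := List.map_getElem_sublist (l := List.ofFn fun i => (p i : ℕ))
      (is := [i.cast (by simp), j.cast (by simp), k.cast (by simp)])
      (by simp [hij, hjk, hij.trans hjk])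
    simpa using hs
  · rintro h a b d hs ⟨had, hdb⟩
    rw [List.ofFn_eq_map, List.sublist_map_iff] at hs
    obtain ⟨l, hl, he⟩ := hs
    have hlt := (List.pairwise_lt_finRange n).sublist hl
    match l with
    | [i, j, k] =>
      simp only [List.map_cons, List.map_nil, List.cons.injEq, and_true] at he
      obtain ⟨rfl, rfl, rfl⟩ := he
      simp only [List.pairwise_cons, List.mem_cons] at hlt
      exact h ⟨i, j, k, hlt.1 j (by simp), hlt.2.1 k (by simp), had, hdb⟩

theorem exists_ofFn_eq_values (t : BinaryTree Unit) :
    ∃ p : Equiv.Perm (Fin t.numNodes), (List.ofFn fun i => (p i : ℕ)) = values t 0 := by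
  have hlt (i : Fin t.numNodes) : (values t 0)[i]'(by simp [length_values]) < t.numNodes := by
    have := mem_values (List.getElem_mem (l := values t 0) (n := i) (by simp [length_values]))
    simpa using this.2
  have hinj : Function.Injective fun i : Fin t.numNodes => (⟨_, hlt i⟩ : Fin t.numNodes) := by
    intro i j hij
    exact Fin.ext (((nodup_values t 0).getElem_inj_iff).1 (Fin.ext_iff.1 hij))
  refine ⟨.ofBijective _ (Finite.injective_iff_bijective.1 hinj), ?_⟩
  apply List.ext_getElem
  · simp [length_values]
  · intros; simp

theorem ofFn_perm_range' {n : ℕ} (p : Equiv.Perm (Fin n)) :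
    (List.ofFn fun i => (p i : ℕ)).Perm (List.range' 0 n) := by
  have h : ((List.finRange n).map p).Perm (List.finRange n) := by
    refine (List.perm_ext_iff_of_nodup ?_ (List.nodup_finRange n)).2 fun a =>
      ⟨fun _ => List.mem_finRange _, fun _ => List.mem_map.2 ⟨p.symm a, by simp, by simp⟩⟩
    exact (List.nodup_finRange n).map p.injective
  have := h.map ((↑) : Fin n → ℕ)
  rw [List.map_map, List.map_coe_finRange_eq_range] at this
  rw [List.ofFn_eq_map, ← List.range_eq_range']
  exact this

theorem map_permWord_eq (n : ℕ) [DecidablePred (Avoids132 (n := n))] :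
    (Finset.univ.filter (Avoids132 (n := n))).val.map permWord =
      (treesOfNumNodesEq n).val.map peakWord := by
  have hex (p : Equiv.Perm (Fin n)) (hp : Avoids132 p) :
      ∃ t, values t 0 = List.ofFn fun i => (p i : ℕ) :=
    exists_values_eq n 0 _ (ofFn_perm_range' p) ((listAvoids132_ofFn_iff p).2 hp)
  refine Multiset.map_eq_map_of_bij_of_nodup _ _ (Finset.nodup _) (Finset.nodup _)
    (fun p hp => (hex p (Finset.mem_filter.1 hp).2).choose) ?_ ?_ ?_ ?_
  · intro p hp
    have := (hex p (Finset.mem_filter.1 hp).2).choose_spec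
    change _ ∈ treesOfNumNodesEq n
    rw [mem_treesOfNumNodesEq, ← length_values _ 0, this, List.length_ofFn]
  · intro p hp q hq h
    have h1 := (hex p (Finset.mem_filter.1 hp).2).choose_spec
    have h2 := (hex q (Finset.mem_filter.1 hq).2).choose_spec
    rw [h, h2] at h1
    ext i
    exact (congrFun (List.ofFn_injective h1) i).symm
  · intro t ht
    obtain rfl := mem_treesOfNumNodesEq.1 ht
    obtain ⟨p, hp⟩ := exists_ofFn_eq_values t
    have hmem : Avoids132 p := (listAvoids132_ofFn_iff p).1 (hp ▸ listAvoids132_values t 0)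
    refine ⟨p, Finset.mem_filter.2 ⟨Finset.mem_univ _, hmem⟩, values_injective 0 ?_⟩
    exact (hex p hmem).choose_spec.trans hp
  · intro p hp
    have := (hex p (Finset.mem_filter.1 hp).2).choose_spec
    rw [← descentWord_values _ 0, this, permWord]

end DescentTree

/-- The poset of 132-avoiding permutations of `[n]` ordered by containment
of descent sets is `k`-Sperner: any set `A` of 132-avoiding permutations of `[n]` containing
no chain of `k+1` elements (with respect to strict containment of descent sets) has size at
most the sum of the `k` largest values among `a_0, …, a_{n-1}`, where `a_j` counts the
132-avoiding permutations of `[n]` with exactly `j` descents.  The sum of the `k` largest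
values is expressed as the maximum of `∑_{j ∈ T} a_j` over subsets `T` of `{0, …, n-1}` of
size `min k n`. -/
theorem stmt_8 (n k : ℕ) (hn : 0 < n) (hk : 0 < k)
    (A : Finset (Equiv.Perm (Fin n))) (hA : ∀ p ∈ A, Avoids132 p)
    (hchain : ¬ ∃ c : Fin (k + 1) → Equiv.Perm (Fin n),
      (∀ i, c i ∈ A) ∧ ∀ i j : Fin (k + 1), i < j → DescentSet (c i) ⊂ DescentSet (c j)) :
    A.card ≤ ((Finset.range n).powersetCard (min k n)).sup
      (fun T => ∑ j ∈ T, countDesc n j) := by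
  classical
  set T : Finset ℕ := Finset.Ico ((n - min k n) / 2) ((n - min k n) / 2 + min k n) with hT
  have hTmem : T ∈ (Finset.range n).powersetCard (min k n) := by
    rw [Finset.mem_powersetCard]
    refine ⟨fun j hj => ?_, by simp [hT]⟩
    simp only [hT, Finset.mem_Ico] at hj
    rw [Finset.mem_range]
    omega
  refine le_trans ?_ (Finset.le_sup (f := fun T => ∑ j ∈ T, countDesc n j) hTmem)
  have hdec := DescentTree.decomposes_peakWord n
  rw [← DescentTree.map_permWord_eq] at hdec
  have hsub : A.val ≤ (Finset.univ.filter (Avoids132 (n := n))).val :=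
    Finset.val_le_iff.2 fun p hp => Finset.mem_filter.2 ⟨Finset.mem_univ _, hA p hp⟩
  have hcard := hdec.card_le (k := k) (Multiset.map_le_map hsub) (by
    rintro ⟨c, hc, hc'⟩
    simp only [Multiset.mem_map] at hc
    choose d hd hdc using hc
    refine hchain ⟨d, hd, fun i j hij => ?_⟩
    obtain ⟨h1, h2⟩ := hc' i j hij
    rw [← hdc, ← hdc] at h1 h2
    rw [← DescentTree.card_descentSet, ← DescentTree.card_descentSet] at h2
    exact (DescentTree.descentSet_subset h1).ssubset_of_ne fun h => h2.ne (congrArg _ h))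
  rw [Multiset.card_map, Nat.sub_add_cancel hn, ← hT, Multiset.countP_map] at hcard
  refine hcard.trans ?_
  rw [← Finset.filter_val, ← Finset.card_def, Finset.card_eq_sum_card_fiberwise
    (f := fun p => (DescentSet p).card) (t := T)]
  · refine Finset.sum_le_sum fun j hj => ?_
    rw [countDesc, Nat.card_eq_fintype_card, Fintype.card_subtype]
    refine Finset.card_le_card fun p hp => ?_
    simp only [Finset.mem_filter, Finset.mem_univ, true_and] at hp ⊢
    exact ⟨hp.1.1, hp.2⟩
  · intro p hp
    have := (Finset.mem_filter.1 hp).2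
    rwa [← DescentTree.card_descentSet] at this
end
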